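/- Let R be a commutative ring, M an R-module, r a natural number, f_1,…,f_r ∈ Hom_R(M,R) and m_1,…,m_r ∈ M. Then, identifying ⋀^0_R M with R, one has (f_r ∘ ⋯ ∘ f_1)(m_1 ∧ ⋯ ∧ m_r) = det((f_i(m_j))_{1≤i,j≤r}). -/

import Mathlib

open ExteriorAlgebra

variable {R M : Type*} [CommRing R] [AddCommGroup M] [Module R M]

/-- The wedge product `m₁ ∧ ⋯ ∧ mₙ`, as an element of the `n`-th exterior power
`⋀[R]^n M` of `M`. -/
noncomputable def wedgeProd (R : Type*) {M : Type*} [CommRing R] [AddCommGroup M]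
    [Module R M] (n : ℕ) (v : Fin n → M) : ⋀[R]^n M :=
  ⟨ExteriorAlgebra.ιMulti R n v, ExteriorAlgebra.ιMulti_range R n (Set.mem_range_self v)⟩

/-- Given a family `c` of contraction maps (where for `f : M →ₗ[R] R`, `c k f` is to be
the contraction `⋀[R]^k M →ₗ[R] ⋀[R]^(k-1) M` determined by `f`), and linear functionals
`f = (f₁, …, f_s)`, this is the iterated contraction `f_s ∘ ⋯ ∘ f₁ : ⋀[R]^k M →ₗ[R] ⋀[R]^(k-s) M`
(the functional `f₁` being applied first). -/
noncomputable def iterContract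
    (c : ∀ k : ℕ, (M →ₗ[R] R) → (↥(⋀[R]^k M) →ₗ[R] ↥(⋀[R]^(k - 1) M))) :
    (s : ℕ) → (Fin s → (M →ₗ[R] R)) → (k : ℕ) → (↥(⋀[R]^k M) →ₗ[R] ↥(⋀[R]^(k - s) M))
  | 0, _, _ => LinearMap.id
  | s + 1, f, k =>
      (c (k - s) (f (Fin.last s))).comp (iterContract c s (fun i => f i.castSucc) k)

theorem coe_apply_congr
    (c : ∀ k : ℕ, (M →ₗ[R] R) → (↥(⋀[R]^k M) →ₗ[R] ↥(⋀[R]^(k - 1) M)))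
    (g : M →ₗ[R] R) {a b : ℕ} (hab : a = b) (x : ⋀[R]^a M) (y : ⋀[R]^b M)
    (hxy : (x : ExteriorAlgebra R M) = y) :
    (c a g x : ExteriorAlgebra R M) = c b g y := by
  subst hab
  rw [Subtype.ext hxy]

/-- An iterated contraction may be computed by first contracting with the first functional and
then with the remaining ones. -/
theorem coe_iterContract_succ
    (c : ∀ k : ℕ, (M →ₗ[R] R) → (↥(⋀[R]^k M) →ₗ[R] ↥(⋀[R]^(k - 1) M)))
    (s : ℕ) (f : Fin (s + 1) → (M →ₗ[R] R)) (k : ℕ) (x : ⋀[R]^k M) :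
    (iterContract c (s + 1) f k x : ExteriorAlgebra R M) =
      iterContract c s (fun i => f i.succ) (k - 1) (c k (f 0) x) := by
  induction s with
  | zero => rfl
  | succ s ih =>
    exact coe_apply_congr c (f (Fin.last (s + 1))) (by omega) _ _ (ih fun i => f i.castSucc)

/-- Let `R` be a commutative ring, `M` an `R`-module, `r` a natural number,
`f₁,…,f_r ∈ Hom_R(M,R)` and `m₁,…,m_r ∈ M`.  Then, writing `f` also for the contraction
homomorphisms `⋀^k M → ⋀^{k-1} M` determined by `f(m₁ ∧ ⋯ ∧ m_k)
= Σᵢ (−1)^{i+1} f(mᵢ) · m₁ ∧ ⋯ ∧ m̂ᵢ ∧ ⋯ ∧ m_k`, and identifying `⋀^0_R M` with `R`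
(via the unit of the exterior algebra), one has
`(f_r ∘ ⋯ ∘ f₁)(m₁ ∧ ⋯ ∧ m_r) = det((fᵢ(mⱼ))_{1≤i,j≤r})`. -/
theorem iterContract_wedgeProd_eq_det
    (c : ∀ k : ℕ, (M →ₗ[R] R) → (↥(⋀[R]^k M) →ₗ[R] ↥(⋀[R]^(k - 1) M)))
    (hc : ∀ (k : ℕ) (g : M →ₗ[R] R) (v : Fin (k + 1) → M),
        c (k + 1) g (wedgeProd R (k + 1) v) =
          ∑ i : Fin (k + 1), ((-1 : R) ^ (i : ℕ) * g (v i)) •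
            wedgeProd R k (fun j => v (i.succAbove j)))
    (r : ℕ) (f : Fin r → (M →ₗ[R] R)) (m : Fin r → M) :
    (↑(iterContract c r f r (wedgeProd R r m)) : ExteriorAlgebra R M) =
      algebraMap R (ExteriorAlgebra R M)
        (Matrix.det (Matrix.of fun i j : Fin r => f i (m j))) := by
  induction r with
  | zero => simp [iterContract, wedgeProd]
  | succ r ih =>
    rw [coe_iterContract_succ, hc, Matrix.det_succ_row_zero]
    simp only [map_sum, map_smul, Submodule.coe_sum, Submodule.coe_smul]
    refine Finset.sum_congr rfl fun i _ => ?_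
    rw [map_mul, ← Algebra.smul_def]
    exact congrArg _ (ih (fun i => f i.succ) fun j => m (i.succAbove j))
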